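/- Let X and Y be stationary binary chains of infinite order with continuous transition probabilities p^X, p^Y satisfying the ordering condition p^X(1|x) ≤ p^Y(1|y) whenever x ≤ y, and assume Π_{k≥0} α_k > 0 for the associated coupled kernel. Then d̄(X,Y) = P(Y_0 = 1) − P(X_0 = 1), and the infimum is attained by a stationary coupling supported on ordered pairs (X_n ≤ Y_n for all n almost surely). -/

import Mathlib

open MeasureTheory Filter

/-- The shift map on two-sided sequences. -/
def shift {α : Type*} (ω : ℤ → α) : ℤ → α := fun n => ω (n + 1)

/-- The past of a two-sided trajectory, read as `i ↦ ω (-(i+1))`. -/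
def past {α : Type*} (ω : ℤ → α) : ℕ → α := fun i => ω (-(i : ℤ) - 1)

set_option linter.unusedSectionVars false

/-! ### Transfer operators and their oscillation -/

def ocCons {S : Type*} (a : S) (z : ℕ → S) : ℕ → S
  | 0 => a
  | n + 1 => z n

noncomputable def ocOp {S : Type*} [Fintype S] (P : S → (ℕ → S) → ℝ) (f : (ℕ → S) → ℝ) :
    (ℕ → S) → ℝ := fun z => ∑ a, P a z * f (ocCons a z)

def ocOsc {S : Type*} (k : ℕ) (f : (ℕ → S) → ℝ) (b : ℝ) : Prop :=
  ∀ z u : ℕ → S, (∀ i < k, z i = u i) → f z - f u ≤ b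

structure ocMarkov {S : Type*} [Fintype S] (P : S → (ℕ → S) → ℝ) : Prop where
  nonneg : ∀ a z, 0 ≤ P a z
  sum_one : ∀ z, ∑ a, P a z = 1

structure ocMinor {S : Type*} [Fintype S] (P : S → (ℕ → S) → ℝ) (α : ℕ → ℝ) : Prop where
  nonneg : ∀ k, 0 ≤ α k
  le_one : ∀ k, α k ≤ 1
  minor : ∀ k z u, (∀ i < k, z i = u i) → ∃ r : S → ℝ, (∀ a, 0 ≤ r a) ∧
    (∀ a, r a ≤ P a z) ∧ (∀ a, r a ≤ P a u) ∧ α k ≤ ∑ a, r a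

section
variable {S : Type*} [Fintype S] [Nonempty S] {P : S → (ℕ → S) → ℝ} {α : ℕ → ℝ}

lemma ocOsc_mono {k l : ℕ} {f : (ℕ → S) → ℝ} {b c : ℝ} (h : ocOsc k f b) (hk : k ≤ l)
    (hb : b ≤ c) : ocOsc l f c :=
  fun z u hzu => (h z u fun i hi => hzu i (hi.trans_le hk)).trans hb

lemma ocOsc_step (hM : ocMarkov P) (hα : ocMinor P α) {f : (ℕ → S) → ℝ} {k : ℕ} {b B : ℝ}
    (hB : ocOsc 0 f B) (hb : ocOsc (k + 1) f b) (hbB : b ≤ B) :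
    ocOsc k (ocOp P f) (α k * b + (1 - α k) * B) := by
  intro z u hzu
  obtain ⟨r, hr0, hrz, hru, hrs⟩ := hα.minor k z u hzu
  have hag : ∀ a, f (ocCons a z) - f (ocCons a u) ≤ b := by
    intro a
    apply hb
    intro i hi
    cases i with
    | zero => rfl
    | succ i => exact hzu i (by omega)
  obtain ⟨a₀, ha₀⟩ := Finite.exists_max fun a => f (ocCons a z)
  have h1 : ∀ a, P a z * f (ocCons a z) - P a u * f (ocCons a u)
      ≤ r a * b + (P a z - r a) * f (ocCons a₀ z) - (P a u - r a) * (f (ocCons a₀ z) - B) := by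
    intro a
    have e1 := mul_le_mul_of_nonneg_left (hag a) (hr0 a)
    have e2 := mul_le_mul_of_nonneg_left (ha₀ a) (sub_nonneg.2 (hrz a))
    have e3 : f (ocCons a₀ z) - B ≤ f (ocCons a u) := by
      have := hB (ocCons a₀ z) (ocCons a u) (by simp)
      linarith
    have e4 := mul_le_mul_of_nonneg_left e3 (sub_nonneg.2 (hru a))
    nlinarith
  have h2 : ocOp P f z - ocOp P f u ≤ (∑ a, r a) * b + (1 - ∑ a, r a) * B := by
    unfold ocOp
    rw [← Finset.sum_sub_distrib]
    refine (Finset.sum_le_sum fun a _ => h1 a).trans (le_of_eq ?_)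
    simp only [Finset.sum_sub_distrib, Finset.sum_add_distrib, ← Finset.sum_mul, hM.sum_one]
    ring
  nlinarith

lemma ocOsc_op (hM : ocMarkov P) (hα : ocMinor P α) {f : (ℕ → S) → ℝ} {B : ℝ}
    (hB : ocOsc 0 f B) : ocOsc 0 (ocOp P f) B := by
  have := ocOsc_step hM hα (k := 0) hB (ocOsc_mono hB (Nat.zero_le _) le_rfl) le_rfl
  exact ocOsc_mono this le_rfl (by linarith)

lemma ocOsc_iter (hM : ocMarkov P) (hα : ocMinor P α) {f : (ℕ → S) → ℝ} {b B : ℝ}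
    (hB : ocOsc 0 f B) (hbB : b ≤ B) (j : ℕ) : ∀ k, ocOsc (k + j) f b →
    ocOsc k ((ocOp P)^[j] f) ((∏ i ∈ Finset.Ico k (k + j), α i) * b
      + (1 - ∏ i ∈ Finset.Ico k (k + j), α i) * B) := by
  have hB' : ∀ j, ocOsc 0 ((ocOp P)^[j] f) B := by
    intro j
    induction j with
    | zero => exact hB
    | succ j ih => rw [Function.iterate_succ_apply']; exact ocOsc_op hM hα ih
  induction j with
  | zero => intro k h; simpa using h
  | succ j ih =>
    intro k h
    have h1 := ih (k + 1) (by convert h using 1; ring)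
    have hP : ∏ i ∈ Finset.Ico k (k + (j + 1)), α i
        = α k * ∏ i ∈ Finset.Ico (k + 1) (k + 1 + j), α i := by
      rw [Finset.prod_eq_prod_Ico_succ_bot (by omega)]
      congr 2
      congr 1
      ring
    have hp0 : 0 ≤ ∏ i ∈ Finset.Ico (k + 1) (k + 1 + j), α i :=
      Finset.prod_nonneg fun i _ => hα.nonneg i
    have hp1 : ∏ i ∈ Finset.Ico (k + 1) (k + 1 + j), α i ≤ 1 :=
      Finset.prod_le_one (fun i _ => hα.nonneg i) fun i _ => hα.le_one i
    rw [Function.iterate_succ_apply', hP]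
    set p := ∏ i ∈ Finset.Ico (k + 1) (k + 1 + j), α i
    have := ocOsc_step hM hα (hB' j) h1 (by nlinarith)
    refine ocOsc_mono this le_rfl (le_of_eq ?_)
    ring

def ocReg (f : (ℕ → S) → ℝ) : Prop := ∀ ε > 0, ∃ k, ocOsc k f ε

lemma ocReg_op (hM : ocMarkov P) (hα : ocMinor P α) (hα1 : Tendsto α atTop (nhds 1))
    {f : (ℕ → S) → ℝ} {B : ℝ} (hB : ocOsc 0 f B) (hf : ocReg f) : ocReg (ocOp P f) := by
  intro ε hε
  obtain ⟨k, hk⟩ := hf (ε / 2) (by positivity)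
  have hlim : Tendsto (fun k => (1 - α k) * |B|) atTop (nhds 0) := by
    simpa using (hα1.const_sub 1).mul_const |B|
  obtain ⟨l, hlk, hl⟩ := ((eventually_ge_atTop k).and
    (hlim.eventually (gt_mem_nhds (half_pos hε)))).exists
  refine ⟨l, ?_⟩
  set b := min (ε / 2) |B| with hb
  have h1 : ocOsc (l + 1) f b := by
    intro z u h
    apply le_min
    · exact hk z u fun i hi => h i (by omega)
    · exact (hB z u (by simp)).trans (le_abs_self B)
  have h2 := ocOsc_step hM hα (ocOsc_mono hB le_rfl (le_abs_self B)) h1 (min_le_right _ _)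
  refine ocOsc_mono h2 le_rfl ?_
  have e1 : b ≤ ε / 2 := min_le_left _ _
  have e2 : 0 ≤ b := le_min (by positivity) (abs_nonneg B)
  have := hα.le_one l
  have := hα.nonneg l
  nlinarith

lemma ocOsc_contract (hM : ocMarkov P) (hα : ocMinor P α) {A : ℝ} (hA : 0 < A)
    (hprod : ∀ n, A ≤ ∏ k ∈ Finset.range n, α k)
    {f : (ℕ → S) → ℝ} {B : ℝ} (hB0 : 0 < B) (hB : ocOsc 0 f B) (hf : ocReg f) :
    ∃ n, ocOsc 0 ((ocOp P)^[n] f) ((1 - A / 2) * B) := by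
  have hA1 : A ≤ 1 := by simpa using hprod 0
  obtain ⟨n, hn⟩ := hf (A / 2 * B) (by positivity)
  refine ⟨n, ?_⟩
  have hb : A / 2 * B ≤ B := by nlinarith
  have h := ocOsc_iter hM hα hB hb n 0 (by simpa using hn)
  refine ocOsc_mono h le_rfl ?_
  have h2 : A ≤ ∏ i ∈ Finset.Ico 0 (0 + n), α i := by simpa using hprod n
  set p := ∏ i ∈ Finset.Ico 0 (0 + n), α i
  have h3 : A * (B - A / 2 * B) ≤ p * (B - A / 2 * B) :=
    mul_le_mul_of_nonneg_right h2 (by linarith)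
  nlinarith [mul_pos hA hB0]

lemma ocOsc_contract_iter (hM : ocMarkov P) (hα : ocMinor P α) {A : ℝ} (hA : 0 < A)
    (hα1 : Tendsto α atTop (nhds 1))
    (hprod : ∀ n, A ≤ ∏ k ∈ Finset.range n, α k)
    {f : (ℕ → S) → ℝ} {B : ℝ} (hB0 : 0 < B) (hB : ocOsc 0 f B) (hf : ocReg f) (m : ℕ) :
    ∃ n, ocOsc 0 ((ocOp P)^[n] f) ((1 - A / 2) ^ m * B) := by
  have hA1 : A ≤ 1 := by simpa using hprod 0
  induction m with
  | zero => exact ⟨0, by simpa using hB⟩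
  | succ m ih =>
    obtain ⟨n, hn⟩ := ih
    have hreg : ∀ n, ocOsc 0 ((ocOp P)^[n] f) B ∧ ocReg ((ocOp P)^[n] f) := by
      intro n
      induction n with
      | zero => exact ⟨hB, hf⟩
      | succ n ih =>
        rw [Function.iterate_succ_apply']
        exact ⟨ocOsc_op hM hα ih.1, ocReg_op hM hα hα1 ih.1 ih.2⟩
    obtain ⟨n', hn'⟩ := ocOsc_contract hM hα hA hprod
      (mul_pos (pow_pos (by linarith) m) hB0) hn (hreg n).2
    refine ⟨n' + n, ?_⟩
    rw [Function.iterate_add_apply]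
    refine ocOsc_mono hn' le_rfl (le_of_eq ?_)
    ring

lemma ocOp_near (hM : ocMarkov P) {f : (ℕ → S) → ℝ} {c ε : ℝ} (h : ∀ z, |f z - c| ≤ ε) (n : ℕ) :
    ∀ z, |(ocOp P)^[n] f z - c| ≤ ε := by
  induction n with
  | zero => exact h
  | succ n ih =>
    intro z
    rw [Function.iterate_succ_apply']
    have : ocOp P ((ocOp P)^[n] f) z - c
        = ∑ a, P a z * ((ocOp P)^[n] f (ocCons a z) - c) := by
      simp only [mul_sub, Finset.sum_sub_distrib, ← Finset.sum_mul, hM.sum_one, one_mul]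
      rfl
    rw [this]
    calc _ ≤ ∑ a, |P a z * ((ocOp P)^[n] f (ocCons a z) - c)| := Finset.abs_sum_le_sum_abs _ _
      _ ≤ ∑ a, P a z * ε := by
        refine Finset.sum_le_sum fun a _ => ?_
        rw [abs_mul, abs_of_nonneg (hM.nonneg a z)]
        exact mul_le_mul_of_nonneg_left (ih _) (hM.nonneg a z)
      _ = ε := by rw [← Finset.sum_mul, hM.sum_one, one_mul]

lemma ocOp_tendsto (hM : ocMarkov P) (hα : ocMinor P α) {A : ℝ} (hA : 0 < A)
    (hα1 : Tendsto α atTop (nhds 1))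
    (hprod : ∀ n, A ≤ ∏ k ∈ Finset.range n, α k)
    {f : (ℕ → S) → ℝ} {B : ℝ} (hB : ocOsc 0 f B) (hf : ocReg f) :
    ∃ c, ∀ ε > 0, ∃ N, ∀ n ≥ N, ∀ z, |(ocOp P)^[n] f z - c| ≤ ε := by
  have hA1 : A ≤ 1 := by simpa using hprod 0
  obtain ⟨a₀⟩ := ‹Nonempty S›
  let z₀ : ℕ → S := fun _ => a₀
  have key : ∀ ε > 0, ∃ N, ∀ n ≥ N, ∀ z, |(ocOp P)^[n] f z - (ocOp P)^[N] f z₀| ≤ ε := by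
    intro ε hε
    have hB' : ocOsc 0 f (|B| + 1) := ocOsc_mono hB le_rfl (by linarith [le_abs_self B])
    have hp : (0:ℝ) < |B| + 1 := by positivity
    obtain ⟨m, hm⟩ := exists_pow_lt_of_lt_one (div_pos hε hp) (show 1 - A / 2 < 1 by linarith)
    rw [lt_div_iff₀ hp] at hm
    obtain ⟨N, hN⟩ := ocOsc_contract_iter hM hα hA hα1 hprod hp hB' hf m
    refine ⟨N, fun n hn z => ?_⟩
    obtain ⟨j, rfl⟩ := Nat.exists_eq_add_of_le' hn
    rw [Function.iterate_add_apply]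
    refine ocOp_near hM (fun z => ?_) j z
    rw [abs_le]
    have e1 := hN z z₀ (by simp)
    have e2 := hN z₀ z (by simp)
    constructor <;> linarith
  have hc : CauchySeq fun n => (ocOp P)^[n] f z₀ := by
    rw [Metric.cauchySeq_iff']
    intro ε hε
    obtain ⟨N, hN⟩ := key (ε / 2) (by positivity)
    exact ⟨N, fun n hn => by rw [Real.dist_eq]; linarith [hN n hn z₀]⟩
  obtain ⟨c, hc⟩ := cauchySeq_tendsto_of_complete hc
  refine ⟨c, fun ε hε => ?_⟩
  obtain ⟨N, hN⟩ := key (ε / 2) (by positivity)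
  have h2 : |(ocOp P)^[N] f z₀ - c| ≤ ε / 2 := by
    have : Tendsto (fun n => |(ocOp P)^[n] f z₀ - (ocOp P)^[N] f z₀|) atTop
        (nhds |c - (ocOp P)^[N] f z₀|) := (hc.sub_const _).abs
    rw [abs_sub_comm]
    exact le_of_tendsto this ((eventually_ge_atTop N).mono fun n hn => hN n hn z₀)
  refine ⟨N, fun n hn z => ?_⟩
  have := abs_sub_le ((ocOp P)^[n] f z) ((ocOp P)^[N] f z₀) c
  linarith [hN n hn z]

end

/-! ### The two-sided stationary measure -/

def ocPlace {S : Type*} (m : ℕ) (x : ℕ → S) : ℤ → S := fun k => x ((m : ℤ) - k).toNat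

def ocDep {S : Type*} (m : ℕ) (F : (ℤ → S) → ℝ) : Prop :=
  ∀ ω ω' : ℤ → S, (∀ k : ℤ, |k| ≤ m → ω k = ω' k) → F ω = F ω'

section
variable {S : Type*} [Fintype S] [Nonempty S] {P : S → (ℕ → S) → ℝ}

lemma ocOp_add (f g : (ℕ → S) → ℝ) (n : ℕ) :
    (ocOp P)^[n] (f + g) = (ocOp P)^[n] f + (ocOp P)^[n] g := by
  induction n with
  | zero => rfl
  | succ n ih =>
    simp only [Function.iterate_succ_apply', ih]
    funext z
    simp [ocOp, mul_add, Finset.sum_add_distrib]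

lemma ocOp_smul (c : ℝ) (f : (ℕ → S) → ℝ) (n : ℕ) :
    (ocOp P)^[n] (c • f) = c • (ocOp P)^[n] f := by
  induction n with
  | zero => rfl
  | succ n ih =>
    simp only [Function.iterate_succ_apply', ih]
    funext z
    simp only [ocOp, Pi.smul_apply, smul_eq_mul, Finset.mul_sum]
    exact Finset.sum_congr rfl fun a _ => by ring

lemma ocOp_nonneg (hM : ocMarkov P) {f : (ℕ → S) → ℝ} (hf : ∀ z, 0 ≤ f z) (n : ℕ) :
    ∀ z, 0 ≤ (ocOp P)^[n] f z := by
  induction n with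
  | zero => exact hf
  | succ n ih =>
    intro z
    rw [Function.iterate_succ_apply']
    exact Finset.sum_nonneg fun a _ => mul_nonneg (hM.nonneg a z) (ih _)

lemma ocOp_one (hM : ocMarkov P) (n : ℕ) (z : ℕ → S) : (ocOp P)^[n] (fun _ => 1) z = 1 := by
  have := ocOp_near hM (f := fun _ => 1) (c := 1) (ε := 0) (by simp) n z
  have := abs_nonpos_iff.1 this
  linarith

lemma ocOp_tail (hM : ocMarkov P) (h : (ℕ → S) → ℝ) (j i : ℕ) :
    (ocOp P)^[i + j] (fun x => h fun l => x (l + j)) = (ocOp P)^[i] h := by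
  induction j with
  | zero => rfl
  | succ j ih =>
    rw [← ih, ← add_assoc, Function.iterate_succ_apply]
    congr 1
    funext z
    have : ∀ a, (fun l => ocCons a z (l + (j + 1))) = fun l => z (l + j) := fun a => rfl
    simp only [ocOp, this, ← Finset.sum_mul, hM.sum_one, one_mul]

lemma ocPlace_dep {m n : ℕ} (hmn : m ≤ n) {F : (ℤ → S) → ℝ} (hF : ocDep m F) (x : ℕ → S) :
    F (ocPlace n x) = F (ocPlace m fun l => x (l + (n - m))) := by
  apply hF
  intro k hk
  have := (abs_le.1 hk).2
  simp only [ocPlace]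
  congr 1
  omega

variable [TopologicalSpace S] [DiscreteTopology S]

lemma ocDep_continuous {m : ℕ} {F : (ℤ → S) → ℝ} (hF : ocDep m F) : Continuous F := by
  apply IsLocallyConstant.continuous
  rw [IsLocallyConstant.iff_exists_open]
  intro ω
  refine ⟨(Set.Icc (-(m:ℤ)) m).pi fun k => {ω k},
    isOpen_set_pi (Set.finite_Icc _ _) fun k _ => isOpen_discrete _, fun k _ => rfl, ?_⟩
  intro ω' h
  exact hF _ _ fun k hk => h k (abs_le.1 hk)

variable [MeasurableSpace S] [BorelSpace S]

theorem oc_exists (hM : ocMarkov P) (z₀ : ℕ → S) :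
    ∃ π : Measure (ℤ → S), IsProbabilityMeasure π ∧ ∀ (m : ℕ) (F : (ℤ → S) → ℝ), ocDep m F →
      ∀ c, Tendsto (fun n => (ocOp P)^[n] (fun x => F (ocPlace m x)) z₀) atTop (nhds c) →
        ∫ ω, F ω ∂π = c := by
  let φ : ((ℤ → S) → ℝ) → ℕ → ℝ := fun F n => (ocOp P)^[n + n] (fun x => F (ocPlace n x)) z₀
  have hbd : ∀ F : CompactlySupportedContinuousMap (ℤ → S) ℝ,
      ∃ l, Tendsto (φ F) (hyperfilter ℕ) (nhds l) := by
    intro F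
    obtain ⟨C, hC⟩ := (isCompact_range F.continuous).isBounded.exists_norm_le
    have hC' : ∀ n, φ F n ∈ Set.Icc (-C) C := by
      intro n
      have := ocOp_near hM (f := fun x => F (ocPlace n x)) (c := 0) (ε := C)
        (fun z => by simpa using hC _ (Set.mem_range_self (ocPlace n z))) (n + n) z₀
      rw [sub_zero, abs_le] at this
      exact this
    obtain ⟨l, -, hl⟩ := (isCompact_Icc (a := -C) (b := C)).ultrafilter_le_nhds
      ((hyperfilter ℕ).map (φ F)) (by
        rw [le_principal_iff]
        exact Filter.mem_map.2 (Filter.univ_mem' hC'))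
    exact ⟨l, hl⟩
  choose Λ hΛ using hbd
  let Λ' : CompactlySupportedContinuousMap (ℤ → S) ℝ →ₗ[ℝ] ℝ :=
    { toFun := Λ
      map_add' := by
        intro F G
        refine tendsto_nhds_unique (hΛ (F + G)) (((hΛ F).add (hΛ G)).congr fun n => ?_)
        exact (congrFun (ocOp_add (P := P) (fun x => F (ocPlace n x)) (fun x => G (ocPlace n x))
          (n + n)) z₀).symm
      map_smul' := by
        intro c F
        refine tendsto_nhds_unique (hΛ (c • F)) (((hΛ F).const_mul c).congr fun n => ?_)
        exact (congrFun (ocOp_smul (P := P) c (fun x => F (ocPlace n x)) (n + n)) z₀).symm }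
  let Λp : CompactlySupportedContinuousMap (ℤ → S) ℝ →ₚ[ℝ] ℝ :=
    PositiveLinearMap.mk₀ Λ' (by
      intro F hF
      exact ge_of_tendsto' (hΛ F) fun n => ocOp_nonneg hM (fun z => hF (ocPlace n z)) _ _)
  let π := RealRMK.rieszMeasure Λp
  have hint : ∀ (m : ℕ) (F : (ℤ → S) → ℝ), ocDep m F →
      ∀ c, Tendsto (fun n => (ocOp P)^[n] (fun x => F (ocPlace m x)) z₀) atTop (nhds c) →
        ∫ ω, F ω ∂π = c := by
    intro m F hF c hc
    let F' : CompactlySupportedContinuousMap (ℤ → S) ℝ :=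
      CompactlySupportedContinuousMap.continuousMapEquiv ⟨F, ocDep_continuous hF⟩
    have h1 : ∫ ω, F' ω ∂π = Λ F' := RealRMK.integral_rieszMeasure Λp F'
    refine Eq.trans h1 (tendsto_nhds_unique (hΛ F') ?_)
    have h2 : Tendsto (fun n => (ocOp P)^[n + m] (fun x => F (ocPlace m x)) z₀)
        (hyperfilter ℕ) (nhds c) :=
      (hc.comp (tendsto_add_atTop_nat m)).mono_left Nat.hyperfilter_le_atTop
    refine h2.congr' ?_
    have : ∀ᶠ n in (hyperfilter ℕ : Filter ℕ), m ≤ n :=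
      Nat.hyperfilter_le_atTop (eventually_ge_atTop m)
    filter_upwards [this] with n hn
    have e1 : (fun x => F (ocPlace n x))
        = fun x : ℕ → S => F (ocPlace m fun l => x (l + (n - m))) :=
      funext fun x => ocPlace_dep hn hF x
    change _ = (ocOp P)^[n + n] (fun x => F (ocPlace n x)) z₀
    rw [e1, ← ocOp_tail hM (fun x => F (ocPlace m x)) (n - m) (n + m)]
    have e2 : n + m + (n - m) = n + n := by omega
    rw [e2]
  refine ⟨π, ?_, hint⟩
  have h1 : ∫ ω : ℤ → S, (1:ℝ) ∂π = 1 := by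
    refine hint 0 (fun _ => 1) (fun _ _ _ => rfl) 1 ?_
    simp only [ocOp_one hM]
    exact tendsto_const_nhds
  rw [integral_const, smul_eq_mul, mul_one] at h1
  exact ⟨(ENNReal.toReal_eq_one_iff _).1 h1⟩

/-- two finite measures agreeing on cylinder functions are equal -/
lemma oc_ext {π π' : Measure (ℤ → S)} [IsProbabilityMeasure π] [IsProbabilityMeasure π']
    (h : ∀ (m : ℕ) (F : (ℤ → S) → ℝ), ocDep m F → ∫ ω, F ω ∂π = ∫ ω, F ω ∂π') : π = π' := by
  refine ext_of_generate_finite (measurableCylinders fun _ : ℤ => S)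
    generateFrom_measurableCylinders.symm isPiSystem_measurableCylinders ?_ (by simp)
  intro C hC
  have hCm : MeasurableSet C := MeasurableSet.of_mem_measurableCylinders hC
  obtain ⟨s, T, hT, rfl⟩ := (mem_measurableCylinders _).1 hC
  have h1 := h (s.sup Int.natAbs) ((cylinder s T).indicator fun _ => 1) (by
    intro ω ω' hω
    have : s.restrict ω = s.restrict ω' := by
      funext ⟨i, hi⟩
      apply hω
      have := Finset.le_sup (f := Int.natAbs) hi
      rw [Int.abs_eq_natAbs]
      exact_mod_cast this
    have h2 : ω ∈ cylinder s T ↔ ω' ∈ cylinder s T := by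
      rw [mem_cylinder, mem_cylinder, this]
    by_cases h3 : ω ∈ cylinder s T
    · rw [Set.indicator_of_mem h3, Set.indicator_of_mem (h2.1 h3)]
    · rw [Set.indicator_of_notMem h3, Set.indicator_of_notMem (fun h4 => h3 (h2.2 h4))])
  rw [integral_indicator_const _ hCm, integral_indicator_const _ hCm] at h1
  simpa [measureReal_def, ENNReal.toReal_eq_toReal_iff] using h1

end

/-! ### Stationary chains are determined by the transfer operator -/

def ocBool (p : (ℕ → Bool) → ℝ) : Bool → (ℕ → Bool) → ℝ :=
  fun b x => if b = true then p x else 1 - p x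

lemma oc_continuous {p : (ℕ → Bool) → ℝ} {β : ℕ → ℝ} (hβ : Tendsto β atTop (nhds 0))
    (hcont : ∀ (k : ℕ) (x u : ℕ → Bool), (∀ i < k, x i = u i) → |p x - p u| ≤ β k) :
    Continuous p := by
  rw [continuous_iff_continuousAt]
  intro x
  rw [ContinuousAt, Metric.tendsto_nhds]
  intro ε hε
  obtain ⟨k, hk⟩ := (hβ.eventually (gt_mem_nhds hε)).exists
  have hopen : IsOpen ((Set.Iio k).pi fun i => ({x i} : Set Bool)) :=
    isOpen_set_pi (Set.finite_Iio k) fun i _ => isOpen_discrete _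
  filter_upwards [hopen.mem_nhds (fun i _ => rfl)] with u hu
  rw [Real.dist_eq]
  exact (hcont k u x fun i hi => hu i hi).trans_lt hk

lemma ocCons_continuous {S : Type*} [TopologicalSpace S] (a : S) : Continuous (ocCons a) := by
  refine continuous_pi fun i => ?_
  cases i with
  | zero => exact continuous_const
  | succ i => exact continuous_apply i

lemma ocOp_continuous {p : (ℕ → Bool) → ℝ} (hp : Continuous p) {g : (ℕ → Bool) → ℝ}
    (hg : Continuous g) : Continuous (ocOp (ocBool p) g) := by
  unfold ocOp
  refine continuous_finsetSum _ fun a _ => ?_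
  refine Continuous.mul ?_ (hg.comp (ocCons_continuous a))
  cases a
  · exact continuous_const.sub hp
  · exact hp

lemma oc_past_measurable {S : Type*} [MeasurableSpace S] :
    Measurable (past : (ℤ → S) → ℕ → S) :=
  measurable_pi_lambda _ fun _ => measurable_pi_apply _

lemma oc_shift_measurable {S : Type*} [MeasurableSpace S] :
    Measurable (shift : (ℤ → S) → ℤ → S) :=
  measurable_pi_lambda _ fun _ => measurable_pi_apply _

lemma oc_past_shift {S : Type*} (ω : ℤ → S) : past (shift ω) = ocCons (ω 0) (past ω) := by
  funext i
  cases i with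
  | zero => simp [past, shift, ocCons]
  | succ i =>
    simp only [past, shift, ocCons]
    congr 1
    push_cast
    ring

lemma oc_integrable {μ : Measure (ℤ → Bool)} [IsProbabilityMeasure μ] {g : (ℕ → Bool) → ℝ}
    (hg : Continuous g) : Integrable (fun ω => g (past ω)) μ := by
  obtain ⟨C, hC⟩ := (isCompact_range hg).isBounded.exists_norm_le
  exact Integrable.of_bound (hg.measurable.comp oc_past_measurable).aestronglyMeasurable C
    (Eventually.of_forall fun ω => hC _ (Set.mem_range_self _))

section
variable {μ : Measure (ℤ → Bool)} [IsProbabilityMeasure μ] {p : (ℕ → Bool) → ℝ}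

lemma oc_chain_integral (hp : Continuous p) (hp0 : ∀ x, 0 ≤ p x)
    (hchain : ∀ A : Set (ℤ → Bool), MeasurableSet A →
      (∀ ω ω' : ℤ → Bool, (∀ n < 0, ω n = ω' n) → (ω ∈ A ↔ ω' ∈ A)) →
      (μ ({ω | ω 0 = true} ∩ A)).toReal = ∫ ω in A, p (past ω) ∂μ)
    {d : (ℕ → Bool) → ℝ} (hd : Continuous d) :
    ∫ ω in {ω | ω 0 = true}, d (past ω) ∂μ = ∫ ω, p (past ω) * d (past ω) ∂μ := by
  have hm : (μ.restrict {ω | ω 0 = true}).map past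
      = (μ.map past).withDensity fun x => ENNReal.ofReal (p x) := by
    ext B hB
    have hA : MeasurableSet (past ⁻¹' B : Set (ℤ → Bool)) := oc_past_measurable hB
    rw [Measure.map_apply oc_past_measurable hB, Measure.restrict_apply hA,
      withDensity_apply _ hB, setLIntegral_map hB hp.measurable.ennreal_ofReal oc_past_measurable,
      ← ofReal_integral_eq_lintegral_ofReal (oc_integrable hp).integrableOn
        (Eventually.of_forall fun ω => hp0 _), ← hchain _ hA ?_,
      ENNReal.ofReal_toReal (measure_ne_top _ _), Set.inter_comm]
    intro ω ω' h
    have : past ω = past ω' := funext fun i => h _ (by omega)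
    rw [Set.mem_preimage, Set.mem_preimage, this]
  calc ∫ ω in {ω | ω 0 = true}, d (past ω) ∂μ
      = ∫ x, d x ∂((μ.restrict {ω | ω 0 = true}).map past) :=
        (integral_map oc_past_measurable.aemeasurable hd.aestronglyMeasurable).symm
    _ = ∫ x, (ENNReal.ofReal (p x)).toReal • d x ∂(μ.map past) := by
        rw [hm, integral_withDensity_eq_integral_toReal_smul hp.measurable.ennreal_ofReal
          (Eventually.of_forall fun x => ENNReal.ofReal_lt_top)]
    _ = ∫ x, p x * d x ∂(μ.map past) := by
        simp only [ENNReal.toReal_ofReal (hp0 _), smul_eq_mul]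
    _ = _ := integral_map oc_past_measurable.aemeasurable (hp.mul hd).aestronglyMeasurable

lemma oc_shift_integral (hμs : Measure.map shift μ = μ) {g : (ℕ → Bool) → ℝ}
    (hg : Continuous g) : ∫ ω, g (past (shift ω)) ∂μ = ∫ ω, g (past ω) ∂μ := by
  conv_rhs => rw [← hμs]
  exact (integral_map oc_shift_measurable.aemeasurable
    (hg.measurable.comp oc_past_measurable).aestronglyMeasurable).symm

lemma oc_invariant (hμs : Measure.map shift μ = μ) (hp : Continuous p) (hp0 : ∀ x, 0 ≤ p x)
    (hchain : ∀ A : Set (ℤ → Bool), MeasurableSet A →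
      (∀ ω ω' : ℤ → Bool, (∀ n < 0, ω n = ω' n) → (ω ∈ A ↔ ω' ∈ A)) →
      (μ ({ω | ω 0 = true} ∩ A)).toReal = ∫ ω in A, p (past ω) ∂μ)
    {g : (ℕ → Bool) → ℝ} (hg : Continuous g) :
    ∫ ω, ocOp (ocBool p) g (past ω) ∂μ = ∫ ω, g (past ω) ∂μ := by
  have hg0 := hg.comp (ocCons_continuous false)
  have hd := (hg.comp (ocCons_continuous true)).sub hg0
  have hE : MeasurableSet {ω : ℤ → Bool | ω 0 = true} :=
    measurable_pi_apply (X := fun _ : ℤ => Bool) 0 (measurableSet_singleton true)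
  rw [← oc_shift_integral hμs hg]
  have e1 : ∀ ω : ℤ → Bool, g (past (shift ω)) =
      {ω : ℤ → Bool | ω 0 = true}.indicator
        (fun ω => g (ocCons true (past ω)) - g (ocCons false (past ω))) ω
      + g (ocCons false (past ω)) := by
    intro ω
    rw [oc_past_shift]
    cases h : ω 0 <;> simp [h]
  have e2 : ∀ ω : ℤ → Bool, ocOp (ocBool p) g (past ω) =
      p (past ω) * (g (ocCons true (past ω)) - g (ocCons false (past ω)))
      + g (ocCons false (past ω)) := by
    intro ω
    simp only [ocOp, ocBool, Fintype.sum_bool]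
    simp
    ring
  simp only [e1, e2]
  have i0 : Integrable (fun ω => g (ocCons false (past ω))) μ := oc_integrable hg0
  have i1 : Integrable (fun ω => g (ocCons true (past ω)) - g (ocCons false (past ω))) μ :=
    oc_integrable hd
  have i2 : Integrable
      (fun ω => p (past ω) * (g (ocCons true (past ω)) - g (ocCons false (past ω)))) μ :=
    oc_integrable (hp.mul hd)
  rw [integral_add i2 i0, integral_add (i1.indicator hE) i0, integral_indicator hE]
  congr 1
  exact (oc_chain_integral hp hp0 hchain hd).symm

lemma ocPlace_continuous {S : Type*} [TopologicalSpace S] (m : ℕ) :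
    Continuous (ocPlace m : (ℕ → S) → ℤ → S) :=
  continuous_pi fun _ => continuous_apply _

lemma oc_chain_value (hμs : Measure.map shift μ = μ) (hp : Continuous p) (hp0 : ∀ x, 0 ≤ p x)
    (hchain : ∀ A : Set (ℤ → Bool), MeasurableSet A →
      (∀ ω ω' : ℤ → Bool, (∀ n < 0, ω n = ω' n) → (ω ∈ A ↔ ω' ∈ A)) →
      (μ ({ω | ω 0 = true} ∩ A)).toReal = ∫ ω in A, p (past ω) ∂μ)
    {m : ℕ} {F : (ℤ → Bool) → ℝ} (hF : ocDep m F) {c : ℝ}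
    (hc : ∀ ε > 0, ∃ n, ∀ x, |(ocOp (ocBool p))^[n] (fun x => F (ocPlace m x)) x - c| ≤ ε) :
    ∫ ω, F ω ∂μ = c := by
  have hh : Continuous fun x => F (ocPlace m x) :=
    (ocDep_continuous hF).comp (ocPlace_continuous m)
  have h1 : ∀ n, Continuous ((ocOp (ocBool p))^[n] (fun x => F (ocPlace m x))) ∧
      ∫ ω, (ocOp (ocBool p))^[n] (fun x => F (ocPlace m x)) (past ω) ∂μ
        = ∫ ω, F (ocPlace m (past ω)) ∂μ := by
    intro n
    induction n with
    | zero => exact ⟨hh, rfl⟩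
    | succ n ih =>
      rw [Function.iterate_succ_apply']
      exact ⟨ocOp_continuous hp ih.1, (oc_invariant hμs hp hp0 hchain ih.1).trans ih.2⟩
  have h2 : ∫ ω, F ω ∂μ = ∫ ω, F (ocPlace m (past ω)) ∂μ := by
    have hsn : MeasurePreserving (shift^[m + 1]) μ μ :=
      MeasurePreserving.iterate ⟨oc_shift_measurable, hμs⟩ (m + 1)
    have hit : ∀ (n : ℕ) (ω : ℤ → Bool) (k : ℤ), shift^[n] ω k = ω (k + n) := by
      intro n
      induction n with
      | zero => intro ω k; simp
      | succ n ih =>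
        intro ω k
        rw [Function.iterate_succ_apply, ih]
        simp only [shift]
        congr 1
        push_cast
        ring
    have h3 : ∫ ω, F (ocPlace m (past (shift^[m + 1] ω))) ∂μ
        = ∫ ω, F (ocPlace m (past ω)) ∂μ := by
      conv_rhs => rw [← hsn.map_eq]
      exact (integral_map hsn.measurable.aemeasurable
        (hh.measurable.comp oc_past_measurable).aestronglyMeasurable).symm
    rw [← h3]
    congr 1
    funext ω
    apply hF
    intro k hk
    have := (abs_le.1 hk).2
    simp only [ocPlace, past, hit]
    congr 1
    push_cast
    omega
  rw [h2]
  refine eq_of_forall_dist_le fun ε hε => ?_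
  rw [Real.dist_eq]
  obtain ⟨n, hn⟩ := hc ε hε
  rw [← (h1 n).2]
  have : ∫ ω, (ocOp (ocBool p))^[n] (fun x => F (ocPlace m x)) (past ω) ∂μ - c
      = ∫ ω, ((ocOp (ocBool p))^[n] (fun x => F (ocPlace m x)) (past ω) - c) ∂μ := by
    rw [integral_sub (oc_integrable (h1 n).1) (integrable_const _)]
    simp
  rw [this, ← Real.norm_eq_abs]
  refine (norm_integral_le_of_norm_le_const (C := ε) (Eventually.of_forall fun ω => ?_)).trans ?_
  · exact hn _
  · simp

end

/-! ### The coupled chain on ordered pairs -/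

abbrev OcS : Type := {q : Bool × Bool // q.1 ≤ q.2}

instance : Nonempty OcS := ⟨⟨(false, false), le_rfl⟩⟩

lemma ocS_sum (g : OcS → ℝ) : ∑ a, g a = g ⟨(false, false), by decide⟩
    + g ⟨(false, true), by decide⟩ + g ⟨(true, true), by decide⟩ := by
  have : (Finset.univ : Finset OcS) = {⟨(false, false), by decide⟩,
    ⟨(false, true), by decide⟩, ⟨(true, true), by decide⟩} := by decide
  rw [this, Finset.sum_insert (by decide), Finset.sum_insert (by decide), Finset.sum_singleton]
  ring

section
variable {S : Type*} [Fintype S] [Nonempty S] {P : S → (ℕ → S) → ℝ} {α : ℕ → ℝ}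
  [TopologicalSpace S] [DiscreteTopology S]

lemma oc_conv (hM : ocMarkov P) (hα : ocMinor P α) {A : ℝ} (hA : 0 < A)
    (hα1 : Tendsto α atTop (nhds 1)) (hprod : ∀ n, A ≤ ∏ k ∈ Finset.range n, α k)
    (m : ℕ) (F : (ℤ → S) → ℝ) (hF : ocDep m F) :
    ∃ c, ∀ ε > 0, ∃ N, ∀ n ≥ N, ∀ z, |(ocOp P)^[n] (fun x => F (ocPlace m x)) z - c| ≤ ε := by
  obtain ⟨C, hC⟩ := (isCompact_range (ocDep_continuous hF)).isBounded.exists_norm_le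
  refine ocOp_tendsto hM hα hA hα1 hprod (B := C + C) ?_ ?_
  · intro z u _
    have h1 := abs_le.1 (hC _ (Set.mem_range_self (ocPlace m z)))
    have h2 := abs_le.1 (hC _ (Set.mem_range_self (ocPlace m u)))
    linarith [h1.2, h2.1]
  · intro ε hε
    refine ⟨2 * m + 1, fun z u h => ?_⟩
    have : F (ocPlace m z) = F (ocPlace m u) := by
      apply hF
      intro k hk
      have := (abs_le.1 hk).1
      exact h _ (by omega)
    linarith

variable [MeasurableSpace S] [BorelSpace S]

lemma oc_uniform_tendsto {f : (ℕ → S) → ℝ} {c : ℝ}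
    (h : ∀ ε > 0, ∃ N, ∀ n ≥ N, ∀ z, |(ocOp P)^[n] f z - c| ≤ ε) (z : ℕ → S) :
    Tendsto (fun n => (ocOp P)^[n] f z) atTop (nhds c) := by
  rw [Metric.tendsto_atTop]
  intro ε hε
  obtain ⟨N, hN⟩ := h (ε / 2) (by positivity)
  exact ⟨N, fun n hn => by rw [Real.dist_eq]; linarith [hN n hn z]⟩

lemma oc_stationary {π : Measure (ℤ → S)} [IsProbabilityMeasure π] {z₀ : ℕ → S}
    (hπ : ∀ (m : ℕ) (F : (ℤ → S) → ℝ), ocDep m F →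
      ∀ c, Tendsto (fun n => (ocOp P)^[n] (fun x => F (ocPlace m x)) z₀) atTop (nhds c) →
        ∫ ω, F ω ∂π = c)
    (hconv : ∀ (m : ℕ) (F : (ℤ → S) → ℝ), ocDep m F →
      ∃ c, ∀ ε > 0, ∃ N, ∀ n ≥ N, ∀ z, |(ocOp P)^[n] (fun x => F (ocPlace m x)) z - c| ≤ ε) :
    Measure.map shift π = π := by
  have : IsProbabilityMeasure (Measure.map shift π) :=
    Measure.isProbabilityMeasure_map oc_shift_measurable.aemeasurable
  apply oc_ext
  intro m F hF
  obtain ⟨c, hc⟩ := hconv m F hF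
  have hc := oc_uniform_tendsto hc z₀
  rw [integral_map oc_shift_measurable.aemeasurable
    (ocDep_continuous hF).measurable.aestronglyMeasurable, hπ m F hF c hc]
  refine hπ (m + 1) (fun ω => F (shift ω)) ?_ c ?_
  · intro ω ω' h
    apply hF
    intro k hk
    apply h
    push_cast
    rw [abs_le] at hk ⊢
    omega
  · convert hc using 5 with n x
    funext k
    simp only [shift, ocPlace]
    congr 1
    push_cast
    omega

lemma oc_marginal {π : Measure (ℤ → S)} [IsProbabilityMeasure π] {z₀ : ℕ → S}
    (hπ : ∀ (m : ℕ) (F : (ℤ → S) → ℝ), ocDep m F →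
      ∀ c, Tendsto (fun n => (ocOp P)^[n] (fun x => F (ocPlace m x)) z₀) atTop (nhds c) →
        ∫ ω, F ω ∂π = c)
    (hconv : ∀ (m : ℕ) (F : (ℤ → S) → ℝ), ocDep m F →
      ∃ c, ∀ ε > 0, ∃ N, ∀ n ≥ N, ∀ z, |(ocOp P)^[n] (fun x => F (ocPlace m x)) z - c| ≤ ε)
    (pr : S → Bool) (sec : Bool → S) (hsec : ∀ b, pr (sec b) = b) {p : (ℕ → Bool) → ℝ}
    (hop : ∀ (f : (ℕ → Bool) → ℝ) z, ocOp P (fun z => f fun i => pr (z i)) z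
      = ocOp (ocBool p) f fun i => pr (z i))
    {μ : Measure (ℤ → Bool)} [IsProbabilityMeasure μ]
    (hμs : Measure.map shift μ = μ) (hp : Continuous p) (hp0 : ∀ x, 0 ≤ p x)
    (hchain : ∀ A : Set (ℤ → Bool), MeasurableSet A →
      (∀ ω ω' : ℤ → Bool, (∀ n < 0, ω n = ω' n) → (ω ∈ A ↔ ω' ∈ A)) →
      (μ ({ω | ω 0 = true} ∩ A)).toReal = ∫ ω in A, p (past ω) ∂μ) :
    Measure.map (fun ω n => pr (ω n)) π = μ := by
  have hprm : Measurable fun (ω : ℤ → S) (n : ℤ) => pr (ω n) :=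
    measurable_pi_lambda _ fun n =>
      (continuous_of_discreteTopology (f := pr)).measurable.comp (measurable_pi_apply n)
  have : IsProbabilityMeasure (Measure.map (fun (ω : ℤ → S) (n : ℤ) => pr (ω n)) π) :=
    Measure.isProbabilityMeasure_map hprm.aemeasurable
  have hiter : ∀ (n : ℕ) (f : (ℕ → Bool) → ℝ) z,
      (ocOp P)^[n] (fun z => f fun i => pr (z i)) z
        = (ocOp (ocBool p))^[n] f fun i => pr (z i) := by
    intro n
    induction n with
    | zero => intro f z; rfl
    | succ n ih =>
      intro f z
      rw [Function.iterate_succ_apply, Function.iterate_succ_apply, ← ih]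
      rw [show (ocOp P fun z => f fun i => pr (z i))
        = fun z => ocOp (ocBool p) f fun i => pr (z i) from funext fun z => hop f z]
  apply oc_ext
  intro m F hF
  have hF' : ocDep m fun ω : ℤ → S => F fun n => pr (ω n) := by
    intro ω ω' h
    apply hF
    intro k hk
    rw [h k hk]
  obtain ⟨c, hc⟩ := hconv m _ hF'
  rw [integral_map hprm.aemeasurable (ocDep_continuous hF).measurable.aestronglyMeasurable,
    hπ m _ hF' c (oc_uniform_tendsto hc z₀)]
  symm
  refine oc_chain_value hμs hp hp0 hchain hF fun ε hε => ?_
  obtain ⟨N, hN⟩ := hc ε hε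
  refine ⟨N, fun x => ?_⟩
  have h1 := hN N le_rfl fun i => sec (x i)
  have h2 := hiter N (fun x => F (ocPlace m x)) fun i => sec (x i)
  simp only [hsec] at h2
  rw [← h2]
  exact h1

end

/-- Let `X` (law `μ`) and `Y` (law `ν`) be stationary binary chains of
infinite order with continuous transition probabilities `pˣ, pʸ` satisfying the
ordering condition, and assume `Π_k α k > 0` for the associated coupled kernel `Pc`.
Then `d̄(X,Y) = P(Y₀=1) - P(X₀=1)`, the infimum being attained by a stationary
coupling supported on ordered pairs. -/
theorem dbar_attained_for_ordered_chains
    (μ ν : Measure (ℤ → Bool)) [IsProbabilityMeasure μ] [IsProbabilityMeasure ν]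
    (hμs : Measure.map shift μ = μ) (hνs : Measure.map shift ν = ν)
    (pX pY : (ℕ → Bool) → ℝ)
    (hX0 : ∀ x, 0 ≤ pX x) (hX1 : ∀ x, pX x ≤ 1)
    (hY0 : ∀ y, 0 ≤ pY y) (hY1 : ∀ y, pY y ≤ 1)
    -- ordering condition
    (horder : ∀ x y : ℕ → Bool, (∀ i, x i ≤ y i) → pX x ≤ pY y)
    -- continuity of the transition probabilities
    (β : ℕ → ℝ) (hβ : Tendsto β atTop (nhds 0))
    (hcontX : ∀ (k : ℕ) (x u : ℕ → Bool), (∀ i < k, x i = u i) → |pX x - pX u| ≤ β k)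
    (hcontY : ∀ (k : ℕ) (y v : ℕ → Bool), (∀ i < k, y i = v i) → |pY y - pY v| ≤ β k)
    -- `μ` is a chain of infinite order with transition probability `pˣ`:
    -- for every event `A` depending only on the past coordinates,
    -- `μ({ω₀ = 1} ∩ A) = ∫_A pˣ(1 | past) dμ`, and similarly for `ν` and `pʸ`
    (hμchain : ∀ A : Set (ℤ → Bool), MeasurableSet A →
      (∀ ω ω' : ℤ → Bool, (∀ n < 0, ω n = ω' n) → (ω ∈ A ↔ ω' ∈ A)) →
      (μ ({ω | ω 0 = true} ∩ A)).toReal = ∫ ω in A, pX (past ω) ∂μ)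
    (hνchain : ∀ A : Set (ℤ → Bool), MeasurableSet A →
      (∀ ω ω' : ℤ → Bool, (∀ n < 0, ω n = ω' n) → (ω ∈ A ↔ ω' ∈ A)) →
      (ν ({ω | ω 0 = true} ∩ A)).toReal = ∫ ω in A, pY (past ω) ∂ν)
    -- the coupled kernel `Pc` on `S = {(0,0),(0,1),(1,1)}`
    (Pc : Bool × Bool → (ℕ → Bool) → (ℕ → Bool) → ℝ)
    (hPc : ∀ x y : ℕ → Bool,
      Pc (true, true) x y = pX x ∧ Pc (false, false) x y = 1 - pY y ∧
      Pc (false, true) x y = pY y - pX x ∧ Pc (true, false) x y = 0)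
    -- the suffix infima `r k` and the sequence `α k` associated with `Pc`
    (r : ℕ → Bool × Bool → (ℕ → Bool) → (ℕ → Bool) → ℝ)
    (hr : ∀ k ab x y, r k ab x y =
      sInf {c : ℝ | ∃ u v : ℕ → Bool, (∀ i, u i ≤ v i) ∧
        (∀ i < k, u i = x i ∧ v i = y i) ∧ c = Pc ab u v})
    (α : ℕ → ℝ)
    (hα : ∀ k, α k = sInf {c : ℝ | ∃ x y : ℕ → Bool, (∀ i, x i ≤ y i) ∧
      c = r k (false, false) x y + r k (false, true) x y + r k (true, true) x y})
    -- Condition 3: `Π_{k ≥ 0} α k = A > 0`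
    (A : ℝ) (hA : 0 < A)
    (hprod : Tendsto (fun N : ℕ => ∏ k ∈ Finset.range N, α k) atTop (nhds A)) :
    -- every stationary coupling disagrees at time 0 with probability
    -- at least `P(Y₀=1) - P(X₀=1)` ...
    (∀ π : Measure (ℤ → Bool × Bool), IsProbabilityMeasure π →
      Measure.map shift π = π →
      Measure.map (fun ω n => (ω n).1) π = μ →
      Measure.map (fun ω n => (ω n).2) π = ν →
      (ν {ω | ω 0 = true}).toReal - (μ {ω | ω 0 = true}).toReal
        ≤ (π {ω | (ω 0).1 ≠ (ω 0).2}).toReal) ∧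
    -- ... and some stationary coupling, supported on ordered pairs, attains it
    (∃ π : Measure (ℤ → Bool × Bool), IsProbabilityMeasure π ∧
      Measure.map shift π = π ∧
      Measure.map (fun ω n => (ω n).1) π = μ ∧
      Measure.map (fun ω n => (ω n).2) π = ν ∧
      π {ω | ∀ n : ℤ, (ω n).1 ≤ (ω n).2} = 1 ∧
      (π {ω | (ω 0).1 ≠ (ω 0).2}).toReal
        = (ν {ω | ω 0 = true}).toReal - (μ {ω | ω 0 = true}).toReal) := by
  have hfst : Measurable fun (ω : ℤ → Bool × Bool) (n : ℤ) => (ω n).1 :=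
    measurable_pi_lambda _ fun n => measurable_fst.comp (measurable_pi_apply n)
  have hsnd : Measurable fun (ω : ℤ → Bool × Bool) (n : ℤ) => (ω n).2 :=
    measurable_pi_lambda _ fun n => measurable_snd.comp (measurable_pi_apply n)
  have hE : MeasurableSet {ω : ℤ → Bool | ω 0 = true} :=
    measurable_pi_apply (X := fun _ : ℤ => Bool) 0 (measurableSet_singleton true)
  have hm1 : ∀ π : Measure (ℤ → Bool × Bool), Measure.map (fun ω n => (ω n).1) π = μ →
      μ {ω | ω 0 = true} = π {ω | (ω 0).1 = true} := by
    intro π h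
    rw [← h, Measure.map_apply hfst hE]
    rfl
  have hm2 : ∀ π : Measure (ℤ → Bool × Bool), Measure.map (fun ω n => (ω n).2) π = ν →
      ν {ω | ω 0 = true} = π {ω | (ω 0).2 = true} := by
    intro π h
    rw [← h, Measure.map_apply hsnd hE]
    rfl
  refine ⟨?_, ?_⟩
  · intro π hπ _ h1 h2
    rw [hm1 π h1, hm2 π h2]
    have hsub : {ω : ℤ → Bool × Bool | (ω 0).2 = true}
        ⊆ {ω | (ω 0).1 = true} ∪ {ω | (ω 0).1 ≠ (ω 0).2} := by
      intro ω h
      by_cases h' : (ω 0).1 = true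
      · exact Or.inl h'
      · exact Or.inr fun h3 => h' (h3.trans h)
    have h3 : π.real {ω : ℤ → Bool × Bool | (ω 0).2 = true} ≤ _ :=
      (measureReal_mono hsub).trans (measureReal_union_le _ _)
    simp only [measureReal_def] at h3
    linarith
  · -- the coupled kernel on ordered pairs
    let P : OcS → (ℕ → OcS) → ℝ := fun a z => Pc a.1 (fun i => (z i).1.1) (fun i => (z i).1.2)
    have hPc0 : ∀ ab x y, (∀ i, x i ≤ y i) → 0 ≤ Pc ab x y := by
      rintro ⟨a, b⟩ x y hxy
      obtain ⟨h1, h2, h3, h4⟩ := hPc x y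
      have := horder x y hxy
      have := hX0 x
      have := hY1 y
      cases a <;> cases b <;> simp only [h1, h2, h3, h4] <;> linarith
    have hM : ocMarkov P := by
      refine ⟨fun a z => hPc0 _ _ _ fun i => (z i).2, fun z => ?_⟩
      rw [ocS_sum]
      obtain ⟨h1, h2, h3, -⟩ := hPc (fun i => (z i).1.1) (fun i => (z i).1.2)
      simp only [P, h1, h2, h3]
      ring
    have hr0 : ∀ k ab x y, 0 ≤ r k ab x y := by
      intro k ab x y
      rw [hr]
      apply Real.sInf_nonneg
      rintro c ⟨u, v, huv, -, rfl⟩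
      exact hPc0 _ _ _ huv
    have hrle : ∀ k ab x y u v, (∀ i, u i ≤ v i) → (∀ i < k, u i = x i ∧ v i = y i) →
        r k ab x y ≤ Pc ab u v := by
      intro k ab x y u v huv h
      rw [hr]
      refine csInf_le ⟨0, ?_⟩ ⟨u, v, huv, h, rfl⟩
      rintro c ⟨u, v, huv, -, rfl⟩
      exact hPc0 _ _ _ huv
    have hαle : ∀ k (x y : ℕ → Bool), (∀ i, x i ≤ y i) →
        α k ≤ r k (false, false) x y + r k (false, true) x y + r k (true, true) x y := by
      intro k x y hxy
      rw [hα]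
      refine csInf_le ⟨0, ?_⟩ ⟨x, y, hxy, rfl⟩
      rintro c ⟨x, y, -, rfl⟩
      linarith [hr0 k (false, false) x y, hr0 k (false, true) x y, hr0 k (true, true) x y]
    have hminor : ocMinor P α := by
      refine ⟨fun k => ?_, fun k => ?_, fun k z u hzu => ?_⟩
      · rw [hα]
        apply Real.sInf_nonneg
        rintro c ⟨x, y, -, rfl⟩
        linarith [hr0 k (false, false) x y, hr0 k (false, true) x y, hr0 k (true, true) x y]
      · let x : ℕ → Bool := fun _ => false
        have h := hαle k x x fun _ => le_rfl
        have h1 := fun ab => hrle k ab x x x x (fun _ => le_rfl) fun _ _ => ⟨rfl, rfl⟩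
        obtain ⟨e1, e2, e3, -⟩ := hPc x x
        linarith [h1 (false, false), h1 (false, true), h1 (true, true)]
      · refine ⟨fun a => r k a.1 (fun i => (z i).1.1) (fun i => (z i).1.2),
          fun a => hr0 _ _ _ _, fun a => ?_, fun a => ?_, ?_⟩
        · exact hrle _ _ _ _ _ _ (fun i => (z i).2) fun i _ => ⟨rfl, rfl⟩
        · exact hrle _ _ _ _ _ _ (fun i => (u i).2) fun i hi => by
            rw [hzu i hi]; exact ⟨rfl, rfl⟩
        · rw [ocS_sum]
          exact hαle _ _ _ fun i => (z i).2
    have hanti : Antitone fun N : ℕ => ∏ k ∈ Finset.range N, α k := by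
      refine antitone_nat_of_succ_le fun n => ?_
      rw [Finset.prod_range_succ]
      exact mul_le_of_le_one_right (Finset.prod_nonneg fun i _ => hminor.nonneg i)
        (hminor.le_one n)
    have hprodA : ∀ n, A ≤ ∏ k ∈ Finset.range n, α k := fun n => hanti.le_of_tendsto hprod n
    have hα1 : Tendsto α atTop (nhds 1) := by
      have h1 := ((tendsto_add_atTop_iff_nat 1).2 hprod).div hprod hA.ne'
      rw [div_self hA.ne'] at h1
      refine h1.congr fun n => ?_
      have := hA.trans_le (hprodA n)
      simp only [Pi.div_apply, Finset.prod_range_succ]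
      field_simp
    have hconv := oc_conv hM hminor hA hα1 hprodA
    let z₀ : ℕ → OcS := fun _ => ⟨(false, false), le_rfl⟩
    obtain ⟨π, hπP, hπ⟩ := oc_exists hM z₀
    have hstat := oc_stationary hπ hconv
    have hmX : Measure.map (fun (ω : ℤ → OcS) n => (ω n).1.1) π = μ := by
      refine oc_marginal hπ hconv (fun a => a.1.1) (fun b => ⟨(b, b), le_rfl⟩) (fun _ => rfl)
        (p := pX) ?_ hμs (oc_continuous hβ hcontX) hX0 hμchain
      intro f z
      obtain ⟨h1, h2, h3, -⟩ := hPc (fun i => (z i).1.1) (fun i => (z i).1.2)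
      have hc : ∀ a : OcS, (fun i => (ocCons a z i).1.1) = ocCons a.1.1 fun i => (z i).1.1 := by
        intro a
        funext i
        cases i <;> rfl
      simp only [ocOp, ocS_sum, Fintype.sum_bool, P, ocBool, h1, h2, h3, hc]
      simp
      ring
    have hmY : Measure.map (fun (ω : ℤ → OcS) n => (ω n).1.2) π = ν := by
      refine oc_marginal hπ hconv (fun a => a.1.2) (fun b => ⟨(b, b), le_rfl⟩) (fun _ => rfl)
        (p := pY) ?_ hνs (oc_continuous hβ hcontY) hY0 hνchain
      intro f z
      obtain ⟨h1, h2, h3, -⟩ := hPc (fun i => (z i).1.1) (fun i => (z i).1.2)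
      have hc : ∀ a : OcS, (fun i => (ocCons a z i).1.2) = ocCons a.1.2 fun i => (z i).1.2 := by
        intro a
        funext i
        cases i <;> rfl
      simp only [ocOp, ocS_sum, Fintype.sum_bool, P, ocBool, h1, h2, h3, hc]
      simp
      ring
    have hval : Measurable fun (ω : ℤ → OcS) (n : ℤ) => (ω n).1 :=
      measurable_pi_lambda _ fun n => measurable_subtype_coe.comp (measurable_pi_apply n)
    let π' : Measure (ℤ → Bool × Bool) := Measure.map (fun (ω : ℤ → OcS) (n : ℤ) => (ω n).1) π
    have hP' : IsProbabilityMeasure π' := Measure.isProbabilityMeasure_map hval.aemeasurable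
    have hX' : Measure.map (fun ω n => (ω n).1) π' = μ := by
      rw [← hmX]
      exact Measure.map_map hfst hval
    have hY' : Measure.map (fun ω n => (ω n).2) π' = ν := by
      rw [← hmY]
      exact Measure.map_map hsnd hval
    have hle : MeasurableSet {ω : ℤ → Bool × Bool | ∀ n : ℤ, (ω n).1 ≤ (ω n).2} := by
      rw [Set.ofPred_forall]
      refine MeasurableSet.iInter fun n => ?_
      exact measurable_pi_apply (X := fun _ : ℤ => Bool × Bool) n
        (Set.toFinite {q : Bool × Bool | q.1 ≤ q.2}).measurableSet
    have hord : π' {ω : ℤ → Bool × Bool | ∀ n : ℤ, (ω n).1 ≤ (ω n).2} = 1 := by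
      rw [Measure.map_apply hval hle]
      have : (fun (ω : ℤ → OcS) (n : ℤ) => (ω n).1) ⁻¹'
          {ω : ℤ → Bool × Bool | ∀ n : ℤ, (ω n).1 ≤ (ω n).2} = Set.univ := by
        ext ω
        simp only [Set.mem_preimage, Set.mem_univ, iff_true]
        exact fun n => (ω n).2
      rw [this, measure_univ]
    refine ⟨π', hP', ?_, hX', hY', hord, ?_⟩
    · change Measure.map shift (Measure.map _ π) = Measure.map _ π
      conv_rhs => rw [← hstat]
      rw [Measure.map_map oc_shift_measurable hval, Measure.map_map hval oc_shift_measurable]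
      rfl
    · rw [hm1 π' hX', hm2 π' hY']
      have hae : ∀ᵐ ω ∂π', ∀ n : ℤ, (ω n).1 ≤ (ω n).2 := by
        have := (prob_compl_eq_zero_iff hle).2 hord
        exact this
      have hE1 : MeasurableSet {ω : ℤ → Bool × Bool | (ω 0).1 = true} := hfst hE
      have h1 : π' {ω | (ω 0).1 ≠ (ω 0).2}
          = π' ({ω | (ω 0).2 = true} \ {ω | (ω 0).1 = true}) := by
        apply measure_congr
        filter_upwards [hae] with ω hω
        apply propext
        change (ω 0).1 ≠ (ω 0).2 ↔ (ω 0).2 = true ∧ ¬ (ω 0).1 = true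
        have := hω 0
        revert this
        generalize ω 0 = q
        revert q
        decide
      have h2 : π' ({ω | (ω 0).2 = true} ∩ {ω | (ω 0).1 = true}) = π' {ω | (ω 0).1 = true} := by
        apply measure_congr
        filter_upwards [hae] with ω hω
        apply propext
        change ((ω 0).2 = true ∧ (ω 0).1 = true) ↔ (ω 0).1 = true
        have := hω 0
        revert this
        generalize ω 0 = q
        revert q
        decide
      rw [h1]
      have h3 := measureReal_inter_add_sdiff (μ := π') (s := {ω | (ω 0).2 = true}) hE1
      simp only [measureReal_def, h2] at h3
      linarith
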